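/- arXiv:1901.06781 — 3 statements merged into one kernel-verified Lean document; each statement's English description precedes it below -/
import Mathlib

section
/- There exists a primitive root g modulo 3221 such that the cosets X_i = g^i·H (0 ≤ i < 20, indices mod 20) of the subgroup H of 20th-power residues in 𝔽_3221^× form a 10-color Directed Ramsey algebra, i.e., with m = 10: (1) for all i, X_i + X_i = ⋃_{j ≠ i} X_j; (2) for all i, X_i + X_{i+10} = {0} ∪ ⋃_{j ∉ {i, i+10}} X_j; (3) for all i, j with i ≠ j and j ≠ i+10, X_i + X_j = 𝔽_3221 ∖ {0}. -/
open Pointwise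

/-- The set of nonzero `n`-th power residues in `𝔽_p = ZMod p`. -/
def Hpow (p n : ℕ) : Set (ZMod p) := {x | ∃ u : (ZMod p)ˣ, (u : ZMod p) ^ n = x}

/-- The coset `X_i = g^i · H` of the subgroup of `n`-th power residues. -/
noncomputable def Xc (p n : ℕ) [Fact p.Prime] (g : ZMod p) (i : ℤ) : Set (ZMod p) :=
  g ^ i • Hpow p n

instance : Fact (Nat.Prime 3221) := ⟨by norm_num⟩

theorem isPrimitiveRoot_ten : IsPrimitiveRoot (10 : ZMod 3221) 3220 := by
  have key : ∀ n : ℕ, (10 : ZMod 3221) ^ n = 1 ↔ 10 ^ n % 3221 = 1 := fun n => by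
    simpa using ZMod.natCast_eq_natCast_iff' (10 ^ n) 1 3221
  have h : orderOf (10 : ZMod 3221) = 3220 := by
    refine orderOf_eq_of_pow_and_pow_div_prime (by norm_num) ((key _).2 (by decide +kernel)) ?_
    intro q hq hdvd
    rw [show 3220 = 2 * 2 * 5 * 7 * 23 by norm_num] at hdvd
    simp only [hq.dvd_mul, Nat.prime_dvd_prime_iff_eq hq, Nat.prime_two, Nat.prime_five,
      show Nat.Prime 7 by norm_num, show Nat.Prime 23 by norm_num] at hdvd
    rw [Ne, key]
    rcases hdvd with (((rfl | rfl) | rfl) | rfl) | rfl <;> decide +kernel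
  exact h ▸ IsPrimitiveRoot.orderOf _

theorem isPrimitiveRoot_ten_pow : IsPrimitiveRoot ((10 : ZMod 3221) ^ 161) 20 :=
  isPrimitiveRoot_ten.pow (by norm_num) (by norm_num)

theorem ten_ne_zero : (10 : ZMod 3221) ≠ 0 := isPrimitiveRoot_ten.ne_zero (by norm_num)

theorem ten_pow_ne_zero : (10 : ZMod 3221) ^ 161 ≠ 0 := pow_ne_zero _ ten_ne_zero

theorem zpow_ten_pow_eq_iff (i j : ℤ) :
    ((10 : ZMod 3221) ^ 161) ^ i = (10 ^ 161) ^ j ↔ (i : ZMod 20) = (j : ZMod 20) := by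
  rw [← div_eq_one_iff_eq (zpow_ne_zero _ ten_pow_ne_zero), ← zpow_sub₀ ten_pow_ne_zero,
    isPrimitiveRoot_ten_pow.zpow_eq_one_iff_dvd, eq_comm (a := (i : ZMod 20)),
    ZMod.intCast_eq_intCast_iff_dvd_sub]

theorem exists_zpow_ten_eq {x : ZMod 3221} (hx : x ≠ 0) : ∃ m : ℤ, (10 : ZMod 3221) ^ m = x := by
  have h1 : x ^ 3220 = 1 := ZMod.pow_card_sub_one_eq_one hx
  obtain ⟨m, -, hm⟩ := isPrimitiveRoot_ten.eq_pow_of_pow_eq_one h1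
  exact ⟨m, by simpa using hm⟩

/-- The coset of index `i` is a fibre of the power map `x ↦ x ^ 161`. -/
theorem mem_Xc_ten_iff (x : ZMod 3221) (i : ℤ) : x ∈ Xc 3221 20 10 i ↔ x ^ 161 = (10 ^ 161) ^ i := by
  have pow_zpow : ∀ m : ℤ, ((10 : ZMod 3221) ^ m) ^ 161 = (10 ^ 161) ^ m := fun m => by
    rw [← zpow_natCast, ← zpow_natCast, ← zpow_mul, ← zpow_mul, mul_comm]
  constructor
  · rintro ⟨_, ⟨u, rfl⟩, rfl⟩
    have hu : (u : ZMod 3221) ^ 3220 = 1 := ZMod.pow_card_sub_one_eq_one u.ne_zero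
    simp only [smul_eq_mul]
    rw [mul_pow, ← pow_mul, pow_zpow, hu, mul_one]
  · intro h
    have hx : x ≠ 0 := by
      rintro rfl
      rw [zero_pow (by norm_num)] at h
      exact zpow_ne_zero i ten_pow_ne_zero h.symm
    obtain ⟨m, rfl⟩ := exists_zpow_ten_eq hx
    rw [pow_zpow, zpow_ten_pow_eq_iff, eq_comm, ZMod.intCast_eq_intCast_iff_dvd_sub] at h
    obtain ⟨c, hc⟩ := h
    refine ⟨10 ^ (20 * c), ⟨Units.mk0 (10 ^ c) (zpow_ne_zero _ ten_ne_zero), ?_⟩, ?_⟩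
    · rw [Units.val_mk0, ← zpow_natCast, ← zpow_mul, mul_comm]
      rfl
    · simp only [smul_eq_mul]
      rw [← zpow_add₀ ten_ne_zero]
      congr 1
      push_cast at hc
      linarith

theorem zero_notMem_Xc_ten (i : ℤ) : (0 : ZMod 3221) ∉ Xc 3221 20 10 i := by
  rw [mem_Xc_ten_iff, zero_pow (by norm_num)]
  exact (zpow_ne_zero i ten_pow_ne_zero).symm

theorem exists_mem_Xc_ten {x : ZMod 3221} (hx : x ≠ 0) : ∃ j : ℤ, x ∈ Xc 3221 20 10 j := by
  have h : (x ^ 161) ^ 20 = 1 := by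
    rw [← pow_mul]
    exact ZMod.pow_card_sub_one_eq_one hx
  obtain ⟨j, -, hj⟩ := isPrimitiveRoot_ten_pow.eq_pow_of_pow_eq_one h
  exact ⟨j, (mem_Xc_ten_iff _ _).2 (by simpa using hj.symm)⟩

theorem eq_of_mem_Xc_ten {x : ZMod 3221} {i j : ℤ} (hi : x ∈ Xc 3221 20 10 i)
    (hj : x ∈ Xc 3221 20 10 j) : (i : ZMod 20) = (j : ZMod 20) := by
  rw [mem_Xc_ten_iff] at hi hj
  exact (zpow_ten_pow_eq_iff i j).1 (hi.symm.trans hj)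

theorem Xc_ten_congr {i j : ℤ} (h : (i : ZMod 20) = (j : ZMod 20)) :
    Xc 3221 20 10 i = Xc 3221 20 10 j := by
  ext x
  rw [mem_Xc_ten_iff, mem_Xc_ten_iff, (zpow_ten_pow_eq_iff i j).2 h]

theorem ten_pow_zpow_ten : ((10 : ZMod 3221) ^ 161) ^ (10 : ℤ) = -1 := by
  rcases mul_self_eq_one_iff.1 (show (((10 : ZMod 3221) ^ 161) ^ (10 : ℤ)) *
      ((10 : ZMod 3221) ^ 161) ^ (10 : ℤ) = 1 by
    rw [← zpow_add₀ ten_pow_ne_zero]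
    exact (zpow_ten_pow_eq_iff (10 + 10) 0).2 (by decide)) with h | h
  · exact absurd ((zpow_ten_pow_eq_iff 10 0).1 h) (by decide)
  · exact h

theorem neg_mem_Xc_ten {x : ZMod 3221} {i : ℤ} (h : x ∈ Xc 3221 20 10 i) :
    -x ∈ Xc 3221 20 10 (i + 10) := by
  rw [mem_Xc_ten_iff] at *
  rw [zpow_add₀ ten_pow_ne_zero, ten_pow_zpow_ten, Odd.neg_pow (by decide), h, mul_neg_one]

theorem exists_cyclotomic_nat : ∀ d < 20, ∀ l < 20,
    ¬ (d = 0 ∧ l = 0) ∧ ¬ (d = 10 ∧ (l = 0 ∨ l = 10)) →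
    ∃ e ∈ List.range 80, (10 ^ (d + 20 * e) % 3221) ^ 161 % 3221 = (10 ^ 161) ^ d % 3221 ∧
      (1 + 10 ^ (d + 20 * e) % 3221) ^ 161 % 3221 = (10 ^ 161) ^ l % 3221 := by
  decide +kernel

/-- All cyclotomic numbers of order `20` modulo `3221` are nonzero, apart from three. -/
theorem exists_mem_one_add_mem (d l : ZMod 20) (h0 : ¬ (d = 0 ∧ l = 0))
    (h10 : ¬ (d = 10 ∧ (l = 0 ∨ l = 10))) :
    ∃ b : ZMod 3221, b ∈ Xc 3221 20 10 (d.val : ℤ) ∧ 1 + b ∈ Xc 3221 20 10 (l.val : ℤ) := by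
  have h0' : ¬ (d.val = 0 ∧ l.val = 0) := by
    revert d l
    decide
  have h10' : ¬ (d.val = 10 ∧ (l.val = 0 ∨ l.val = 10)) := by
    revert d l
    decide
  obtain ⟨e, -, h1, h2⟩ :=
    exists_cyclotomic_nat d.val (ZMod.val_lt d) l.val (ZMod.val_lt l) ⟨h0', h10'⟩
  rw [← ZMod.natCast_eq_natCast_iff'] at h1 h2
  refine ⟨((10 ^ (d.val + 20 * e) % 3221 : ℕ) : ZMod 3221), ?_, ?_⟩
  · rw [mem_Xc_ten_iff, zpow_natCast]
    exact_mod_cast h1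
  · rw [mem_Xc_ten_iff, zpow_natCast]
    exact_mod_cast h2

theorem one_add_pow_ne_one (b : ZMod 3221) (hb : b ^ 161 = 1) : (1 + b) ^ 161 ≠ 1 := by
  have key : ∀ s < 60, ∀ t < 60, (60 * s + t) ^ 161 % 3221 = 1 →
      (1 + (60 * s + t)) ^ 161 % 3221 ≠ 1 := by decide +kernel
  have cast : ∀ n : ℕ, (n : ZMod 3221) ^ 161 = 1 ↔ n ^ 161 % 3221 = 1 := fun n => by
    rw [← Nat.cast_pow, ← Nat.cast_one, ZMod.natCast_eq_natCast_iff']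
  intro h
  rw [← ZMod.natCast_zmod_val b] at hb h
  have hlt := ZMod.val_lt b
  have := key (b.val / 60) (by omega) (b.val % 60) (by omega)
  rw [Nat.div_add_mod] at this
  exact this ((cast _).1 hb) ((cast _).1 (by rwa [Nat.cast_add, Nat.cast_one]))

theorem add_notMem_Xc_ten {a b : ZMod 3221} {i : ℤ} (ha : a ∈ Xc 3221 20 10 i)
    (hb : b ∈ Xc 3221 20 10 i) : a + b ∉ Xc 3221 20 10 i := by
  intro hab
  have ha0 : a ≠ 0 := fun h => zero_notMem_Xc_ten i (h ▸ ha)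
  rw [mem_Xc_ten_iff] at ha hb hab
  refine one_add_pow_ne_one (b / a) ?_ ?_
  · rw [div_pow, ha, hb, div_self (zpow_ne_zero _ ten_pow_ne_zero)]
  · rw [one_add_div ha0, div_pow, ha, hab, div_self (zpow_ne_zero _ ten_pow_ne_zero)]

theorem mem_add_Xc_ten {x : ZMod 3221} {i j l : ℤ} (hx : x ∈ Xc 3221 20 10 l)
    (h0 : ¬ ((j : ZMod 20) = (i : ZMod 20) ∧ (l : ZMod 20) = (i : ZMod 20)))
    (h10 : ¬ ((j : ZMod 20) = ((i + 10 : ℤ) : ZMod 20) ∧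
      ((l : ZMod 20) = (i : ZMod 20) ∨ (l : ZMod 20) = ((i + 10 : ℤ) : ZMod 20)))) :
    x ∈ Xc 3221 20 10 i + Xc 3221 20 10 j := by
  push_cast at h10
  obtain ⟨b, hb, hb'⟩ := exists_mem_one_add_mem ((j : ZMod 20) - i) ((l : ZMod 20) - i)
    (by simpa only [sub_eq_zero] using h0)
    (by simpa only [sub_eq_iff_eq_add', add_zero] using h10)
  have hne : 1 + b ≠ 0 := fun h => zero_notMem_Xc_ten _ (h ▸ hb')
  rw [Xc_ten_congr (j := j - i) (by simp)] at hb
  rw [Xc_ten_congr (j := l - i) (by simp)] at hb'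
  rw [mem_Xc_ten_iff] at hx hb hb'
  have ha : (x / (1 + b)) ^ 161 = (10 ^ 161) ^ i := by
    rw [div_pow, hx, hb', ← zpow_sub₀ ten_pow_ne_zero, sub_sub_cancel]
  refine ⟨x / (1 + b), (mem_Xc_ten_iff _ _).2 ha, x / (1 + b) * b,
    (mem_Xc_ten_iff _ _).2 ?_, ?_⟩
  · rw [mul_pow, ha, hb, ← zpow_add₀ ten_pow_ne_zero, add_sub_cancel]
  · change x / (1 + b) + x / (1 + b) * b = x
    field_simp

theorem eq_add_ten_of_add_eq_zero {a b : ZMod 3221} {i j : ℤ} (ha : a ∈ Xc 3221 20 10 i)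
    (hb : b ∈ Xc 3221 20 10 j) (h : a + b = 0) :
    (j : ZMod 20) = ((i + 10 : ℤ) : ZMod 20) := by
  rw [eq_neg_of_add_eq_zero_right h] at hb
  exact eq_of_mem_Xc_ten hb (neg_mem_Xc_ten ha)

theorem intCast_ne_add_ten (i : ℤ) : (i : ZMod 20) ≠ ((i + 10 : ℤ) : ZMod 20) := by
  push_cast
  generalize (i : ZMod 20) = t
  revert t
  decide

theorem intCast_add_ten_add_ten (i : ℤ) : ((i + 10 + 10 : ℤ) : ZMod 20) = (i : ZMod 20) := by
  push_cast
  generalize (i : ZMod 20) = t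
  revert t
  decide

/-- The cosets of the index-20 subgroup of `𝔽_3221ˣ` form a 10-color Directed
Ramsey algebra. -/
theorem stmt_13 : ∃ g : ZMod 3221, IsPrimitiveRoot g 3220 ∧
    (∀ i : ℤ, Xc 3221 20 g i + Xc 3221 20 g i =
      ⋃ j ∈ {j : ℤ | (j : ZMod 20) ≠ (i : ZMod 20)}, Xc 3221 20 g j) ∧
    (∀ i : ℤ, Xc 3221 20 g i + Xc 3221 20 g (i + 10) =
      {(0 : ZMod 3221)} ∪ ⋃ j ∈ {j : ℤ | (j : ZMod 20) ≠ (i : ZMod 20) ∧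
        (j : ZMod 20) ≠ ((i + 10 : ℤ) : ZMod 20)}, Xc 3221 20 g j) ∧
    (∀ i j : ℤ, (j : ZMod 20) ≠ (i : ZMod 20) → (j : ZMod 20) ≠ ((i + 10 : ℤ) : ZMod 20) →
      Xc 3221 20 g i + Xc 3221 20 g j = {(0 : ZMod 3221)}ᶜ) := by
  refine ⟨10, isPrimitiveRoot_ten, fun i => ?_, fun i => ?_, fun i j hij hij' => ?_⟩
  · ext x
    simp only [Set.mem_iUnion, Set.mem_ofPred_eq, exists_prop]
    constructor
    · rintro ⟨a, ha, b, hb, rfl⟩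
      obtain ⟨j, hj⟩ := exists_mem_Xc_ten
        (fun h => intCast_ne_add_ten i (eq_add_ten_of_add_eq_zero ha hb h))
      exact ⟨j, fun h => add_notMem_Xc_ten ha hb (Xc_ten_congr h ▸ hj), hj⟩
    · rintro ⟨j, hj, hx⟩
      exact mem_add_Xc_ten hx (fun h => hj h.2) (fun h => intCast_ne_add_ten i h.1)
  · ext x
    simp only [Set.mem_union, Set.mem_singleton_iff, Set.mem_iUnion, Set.mem_ofPred_eq,
      exists_prop]
    constructor
    · rintro ⟨a, ha, b, hb, rfl⟩
      refine or_iff_not_imp_left.2 fun hne => ?_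
      obtain ⟨j, hj⟩ := exists_mem_Xc_ten hne
      have hb' := neg_mem_Xc_ten hb
      rw [Xc_ten_congr (intCast_add_ten_add_ten i)] at hb'
      refine ⟨j, ⟨fun h => ?_, fun h => ?_⟩, hj⟩
      · rw [Xc_ten_congr h] at hj
        exact add_notMem_Xc_ten hj hb' (by simpa using ha)
      · rw [Xc_ten_congr h] at hj
        exact add_notMem_Xc_ten hj (neg_mem_Xc_ten ha) (by simpa using hb)
    · rintro (rfl | ⟨j, ⟨hj, hj'⟩, hx⟩)
      · have h : (10 : ZMod 3221) ^ i ∈ Xc 3221 20 10 i := by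
          refine ⟨1, ⟨1, by simp⟩, by simp⟩
        exact ⟨_, h, _, neg_mem_Xc_ten h, add_neg_cancel _⟩
      · exact mem_add_Xc_ten hx (fun h => hj h.2) (fun h => h.2.elim hj hj')
  · ext x
    simp only [Set.mem_compl_iff, Set.mem_singleton_iff]
    constructor
    · rintro ⟨a, ha, b, hb, rfl⟩ h
      exact hij' (eq_add_ten_of_add_eq_zero ha hb h)
    · intro hx
      obtain ⟨l, hl⟩ := exists_mem_Xc_ten hx
      exact mem_add_Xc_ten hl (fun h => hij h.1) (fun h => hij' h.1)
end

section
/- Let p = 33791 and let H = {x^62 : x ∈ 𝔽_p^×} be the multiplicative subgroup of 𝔽_p^× of index 62 (and odd order 545). Then H + H = 𝔽_p ∖ ({0} ∪ H ∪ (−H)); in particular there are no x, y, z ∈ H with x + y = z or with x + y + z = 0, while H + H contains every element of 𝔽_p^× outside H ∪ (−H). (This is the key computation underlying the finite representation of relation algebra 78_83, with forbidden cycles sss and ssš, over a base set of size 33791.) -/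
open Pointwise

section

local instance fact_prime_33791 : Fact (Nat.Prime 33791) := ⟨by norm_num⟩

theorem mem_Hpow_iff_pow_eq_one (x : ZMod 33791) : x ∈ Hpow 33791 62 ↔ x ^ 545 = 1 := by
  constructor
  · rintro ⟨u, rfl⟩
    rw [← pow_mul]
    exact ZMod.pow_card_sub_one_eq_one u.ne_zero
  · intro h
    have hx : x ≠ 0 := by
      rintro rfl
      simp at h
    refine ⟨Units.mk0 x hx ^ 378, ?_⟩
    calc ((Units.mk0 x hx ^ 378 : (ZMod 33791)ˣ) : ZMod 33791) ^ 62
        = x * (x ^ 545) ^ 43 := by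
          rw [Units.val_pow_eq_pow_val, Units.val_mk0]
          ring
      _ = x := by rw [h, one_pow, mul_one]

/-- Transfers congruences between natural numbers to `ZMod 33791`. -/
theorem natCast_eq_natCast_iff_mod (a b : ℕ) :
    (a : ZMod 33791) = (b : ZMod 33791) ↔ a % 33791 = b % 33791 :=
  ZMod.natCast_eq_natCast_iff' a b 33791

theorem isPrimitiveRoot_natCast {a n : ℕ} (hn : 0 < n) (h : a ^ n % 33791 = 1)
    (h' : ∀ m < n, 0 < m → a ^ m % 33791 ≠ 1) :
    IsPrimitiveRoot (a : ZMod 33791) n := by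
  have key (m : ℕ) : (a : ZMod 33791) ^ m = 1 ↔ a ^ m % 33791 = 1 := by
    simpa using natCast_eq_natCast_iff_mod (a ^ m) 1
  exact IsPrimitiveRoot.mk_of_lt _ hn ((key n).2 h) fun m hm hmn => (key m).not.2 (h' m hmn hm)

theorem exists_natCast_pow_of_mem_Hpow {x : ZMod 33791} (hx : x ∈ Hpow 33791 62) :
    ∃ j < 545, ((110 ^ j : ℕ) : ZMod 33791) = x := by
  have hr : IsPrimitiveRoot ((110 : ℕ) : ZMod 33791) 545 :=
    isPrimitiveRoot_natCast (by norm_num) (by decide +kernel) (by decide +kernel)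
  obtain ⟨j, hj, h⟩ := hr.eq_pow_of_pow_eq_one ((mem_Hpow_iff_pow_eq_one x).1 hx)
  exact ⟨j, hj, by rw [Nat.cast_pow, h]⟩

theorem exists_natCast_pow_of_ne_zero {w : ZMod 33791} (hw : w ≠ 0) :
    ∃ i < 62, ((2397 ^ i : ℕ) : ZMod 33791) = w ^ 545 := by
  have hr : IsPrimitiveRoot ((2397 : ℕ) : ZMod 33791) 62 :=
    isPrimitiveRoot_natCast (by norm_num) (by decide +kernel) (by decide +kernel)
  obtain ⟨i, hi, h⟩ := hr.eq_pow_of_pow_eq_one (ξ := w ^ 545) (by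
    rw [← pow_mul]
    exact ZMod.pow_card_sub_one_eq_one hw)
  exact ⟨i, hi, by rw [Nat.cast_pow, h]⟩

theorem neg_mem_Hpow_iff_pow_eq_neg_one (x : ZMod 33791) :
    -x ∈ Hpow 33791 62 ↔ x ^ 545 = -1 := by
  rw [mem_Hpow_iff_pow_eq_one, Odd.neg_pow (by decide), neg_eq_iff_eq_neg]

theorem one_add_pow_residues :
    ∀ j < 545, (1 + 110 ^ j) ^ 545 % 33791 ≠ 0 ∧ (1 + 110 ^ j) ^ 545 % 33791 ≠ 1 ∧
      (1 + 110 ^ j) ^ 545 % 33791 ≠ 33790 := by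
  have h : ∀ j < 545, (1 + 110 ^ j % 33791) ^ 545 % 33791 ≠ 0 ∧
      (1 + 110 ^ j % 33791) ^ 545 % 33791 ≠ 1 ∧
      (1 + 110 ^ j % 33791) ^ 545 % 33791 ≠ 33790 := by
    decide +kernel
  intro j hj
  simpa [Nat.pow_mod, Nat.add_mod] using h j hj

theorem exists_one_add_pow_residue :
    ∀ i < 62, i ≠ 0 → i ≠ 31 →
      ∃ j < 545, (1 + 110 ^ j % 33791) ^ 545 % 33791 = 2397 ^ i % 33791 := by
  decide +kernel

theorem one_add_pow_ne {y : ZMod 33791} (hy : y ∈ Hpow 33791 62) :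
    (1 + y) ^ 545 ≠ 0 ∧ (1 + y) ^ 545 ≠ 1 ∧ (1 + y) ^ 545 ≠ -1 := by
  obtain ⟨j, hj, rfl⟩ := exists_natCast_pow_of_mem_Hpow hy
  have key (n k : ℕ) : (1 + (n : ZMod 33791)) ^ 545 = k ↔ (1 + n) ^ 545 % 33791 = k % 33791 := by
    rw [← natCast_eq_natCast_iff_mod, Nat.cast_pow, Nat.cast_add, Nat.cast_one]
  have hneg : (-1 : ZMod 33791) = ((33790 : ℕ) : ZMod 33791) := by decide +kernel
  obtain ⟨h₀, h₁, h₂⟩ := one_add_pow_residues j hj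
  generalize 110 ^ j = n at *
  refine ⟨fun h => h₀ ?_, fun h => h₁ ?_, fun h => h₂ ?_⟩
  · exact (key n 0).1 (by rw [h, Nat.cast_zero])
  · exact (key n 1).1 (by rw [h, Nat.cast_one])
  · exact (key n 33790).1 (by rw [h, hneg])

theorem add_notMem_Hpow {x y : ZMod 33791} (hx : x ∈ Hpow 33791 62) (hy : y ∈ Hpow 33791 62) :
    x + y ≠ 0 ∧ x + y ∉ Hpow 33791 62 ∧ -(x + y) ∉ Hpow 33791 62 := by
  rw [neg_mem_Hpow_iff_pow_eq_neg_one, mem_Hpow_iff_pow_eq_one]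
  rw [mem_Hpow_iff_pow_eq_one] at hx hy
  have hx₀ : x ≠ 0 := by
    rintro rfl
    simp at hx
  have hpow : (1 + y / x) ^ 545 = (x + y) ^ 545 := by
    rw [one_add_div hx₀, div_pow, hx, div_one]
  have hyx : y / x ∈ Hpow 33791 62 := by
    rw [mem_Hpow_iff_pow_eq_one, div_pow, hx, hy, div_one]
  obtain ⟨h₀, h₁, h₂⟩ := one_add_pow_ne hyx
  rw [hpow] at h₀ h₁ h₂
  exact ⟨ne_zero_pow (by norm_num) h₀, h₁, h₂⟩

theorem mem_Hpow_add_Hpow {w : ZMod 33791} (hw : w ≠ 0) (h : w ∉ Hpow 33791 62)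
    (h' : -w ∉ Hpow 33791 62) : w ∈ Hpow 33791 62 + Hpow 33791 62 := by
  rw [mem_Hpow_iff_pow_eq_one] at h
  rw [neg_mem_Hpow_iff_pow_eq_neg_one] at h'
  obtain ⟨i, hi, hiw⟩ := exists_natCast_pow_of_ne_zero hw
  have hi₀ : i ≠ 0 := by
    rintro rfl
    exact h (by rw [← hiw, pow_zero, Nat.cast_one])
  have hi₁ : i ≠ 31 := by
    rintro rfl
    exact h' (by rw [← hiw]; decide +kernel)
  obtain ⟨j, -, hj⟩ := exists_one_add_pow_residue i hi hi₀ hi₁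
  set y : ZMod 33791 := ((110 ^ j : ℕ) : ZMod 33791) with hy_def
  have hy : y ^ 545 = 1 := by
    have h110 : ((110 : ℕ) : ZMod 33791) ^ 545 = 1 := by
      rw [← Nat.cast_pow, ← Nat.cast_one, natCast_eq_natCast_iff_mod]
      decide +kernel
    rw [hy_def, Nat.cast_pow, pow_right_comm, h110, one_pow]
  have hyw : (1 + y) ^ 545 = w ^ 545 := by
    rw [← natCast_eq_natCast_iff_mod, hiw, Nat.cast_pow, Nat.cast_add, Nat.cast_one,
      ZMod.natCast_mod] at hj
    exact hj
  have hw' : w ^ 545 ≠ 0 := pow_ne_zero _ hw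
  have hy₁ : 1 + y ≠ 0 := ne_zero_pow (n := 545) (by norm_num) (by rwa [hyw])
  refine Set.mem_add.2 ⟨w / (1 + y), ?_, w / (1 + y) * y, ?_, ?_⟩
  · rw [mem_Hpow_iff_pow_eq_one, div_pow, hyw, div_self hw']
  · rw [mem_Hpow_iff_pow_eq_one, mul_pow, div_pow, hyw, div_self hw', hy, one_mul]
  · rw [← mul_one_add, div_mul_cancel₀ _ hy₁]

end

/-- For `p = 33791` and `H` the subgroup of nonzero `62`-nd power residues,
`H + H = 𝔽_p \ ({0} ∪ H ∪ (-H))`; in particular there are no `x, y, z ∈ H` with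
`x + y = z` or with `x + y + z = 0`, while `H + H` contains every nonzero element
outside `H ∪ (-H)`. -/
theorem stmt_18 :
    Hpow 33791 62 + Hpow 33791 62 =
      ({(0 : ZMod 33791)} ∪ Hpow 33791 62 ∪ (-(Hpow 33791 62)))ᶜ ∧
    (¬ ∃ x ∈ Hpow 33791 62, ∃ y ∈ Hpow 33791 62, ∃ z ∈ Hpow 33791 62, x + y = z) ∧
    (¬ ∃ x ∈ Hpow 33791 62, ∃ y ∈ Hpow 33791 62, ∃ z ∈ Hpow 33791 62, x + y + z = 0) ∧
    (∀ w : ZMod 33791, w ≠ 0 → w ∉ Hpow 33791 62 ∪ (-(Hpow 33791 62)) →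
      w ∈ Hpow 33791 62 + Hpow 33791 62) := by
  refine ⟨?_, ?_, ?_, ?_⟩
  · ext w
    simp only [Set.mem_compl_iff, Set.mem_union, Set.mem_singleton_iff, Set.mem_neg, not_or]
    constructor
    · intro h
      obtain ⟨x, hx, y, hy, rfl⟩ := Set.mem_add.1 h
      obtain ⟨h₀, h₁, h₂⟩ := add_notMem_Hpow hx hy
      exact ⟨⟨h₀, h₁⟩, h₂⟩
    · rintro ⟨⟨h₀, h₁⟩, h₂⟩
      exact mem_Hpow_add_Hpow h₀ h₁ h₂
  · rintro ⟨x, hx, y, hy, z, hz, rfl⟩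
    exact (add_notMem_Hpow hx hy).2.1 hz
  · rintro ⟨x, hx, y, hy, z, hz, h⟩
    exact (add_notMem_Hpow hx hy).2.2 (neg_eq_of_add_eq_zero_right h ▸ hz)
  · intro w hw h
    rw [Set.mem_union, Set.mem_neg, not_or] at h
    exact mem_Hpow_add_Hpow hw h.1 h.2
end

section
/- There exists a primitive root g modulo 73 such that, with X_i = g^i·H (indices mod 8) the cosets of the subgroup H of 8th-power residues in 𝔽_73^×, the four sets R = X_0 ∪ X_1, R̆ = X_4 ∪ X_5, A = X_2 ∪ X_6, B = X_3 ∪ X_7 satisfy: for every ordered pair (S, T) of sets from {R, R̆, A, B}, the sumset S + T contains 𝔽_73 ∖ {0}; moreover 0 ∈ S + T if and only if (S, T) is one of (A, A), (B, B), (R, R̆), (R̆, R). (This gives a finite representation of relation algebra 1316_1316, whose diversity atoms a, b, r, r̆ are all flexible, over a base set of size 73.) -/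
open Pointwise

instance : Fact (Nat.Prime 73) := ⟨by norm_num⟩

/-- The nonzero eighth powers in `𝔽_73` are the ninth roots of unity. -/
theorem mem_Hpow_iff (x : ZMod 73) : x ∈ Hpow 73 8 ↔ x ^ 9 = 1 := by
  constructor
  · rintro ⟨u, rfl⟩
    rw [← pow_mul]
    exact ZMod.pow_card_sub_one_eq_one u.ne_zero
  · intro hx
    have hx0 : x ≠ 0 := by rintro rfl; simp at hx
    refine ⟨Units.mk0 x hx0 ^ 8, ?_⟩
    calc ((Units.mk0 x hx0 ^ 8 : (ZMod 73)ˣ) : ZMod 73) ^ 8 = (x ^ 9) ^ 7 * x := by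
          simp only [Units.val_pow_eq_pow_val, Units.val_mk0]; ring
      _ = x := by rw [hx, one_pow, one_mul]

/-- A coset of the eighth powers is a fibre of `x ↦ x ^ 9`. -/
theorem mem_Xc_iff {g : ZMod 73} (hg : g ≠ 0) (i : ℕ) (x : ZMod 73) :
    x ∈ Xc 73 8 g i ↔ x ^ 9 = (g ^ i) ^ 9 := by
  have hgi : g ^ i ≠ 0 := pow_ne_zero i hg
  rw [Xc, zpow_natCast, Set.mem_smul_set_iff_inv_smul_mem₀ hgi, mem_Hpow_iff, smul_eq_mul,
    mul_pow, inv_pow, inv_mul_eq_one₀ (pow_ne_zero 9 hgi), eq_comm]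

/-- The union of the cosets of `5 ^ i` and `5 ^ j`, as a finset. -/
def cosetPair (i j : ℕ) : Finset (ZMod 73) :=
  Finset.univ.filter fun x => x ^ 9 = (5 ^ i) ^ 9 ∨ x ^ 9 = (5 ^ j) ^ 9

theorem coe_cosetPair (i j : ℕ) :
    (cosetPair i j : Set (ZMod 73)) = Xc 73 8 5 i ∪ Xc 73 8 5 j := by
  have h5 : (5 : ZMod 73) ≠ 0 := by decide
  ext x
  simp [cosetPair, mem_Xc_iff h5]

/-- The sets `R`, `R̆`, `A`, `B` for the primitive root `5`. -/
def atomSet : Fin 4 → Finset (ZMod 73) :=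
  ![cosetPair 0 1, cosetPair 4 5, cosetPair 2 6, cosetPair 3 7]

theorem atomSet_injective : Function.Injective atomSet := by
  decide +kernel

theorem mem_atomSet_add_atomSet :
    ∀ i j : Fin 4, ∀ x : ZMod 73, x ≠ 0 → ∃ a ∈ atomSet i, x - a ∈ atomSet j := by
  decide +kernel

theorem exists_neg_mem_atomSet_iff :
    ∀ i j : Fin 4, (∃ a ∈ atomSet i, -a ∈ atomSet j) ↔
      (i = 2 ∧ j = 2) ∨ (i = 3 ∧ j = 3) ∨ (i = 0 ∧ j = 1) ∨ (i = 1 ∧ j = 0) := by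
  decide +kernel

theorem isPrimitiveRoot_five : IsPrimitiveRoot (5 : ZMod 73) 72 := by
  rw [IsPrimitiveRoot.iff (by norm_num)]
  refine ⟨by decide +kernel, ?_⟩
  have h : ∀ l < 72, 0 < l → (5 : ZMod 73) ^ l ≠ 1 := by decide +kernel
  exact fun l hl hl' => h l hl' hl

/-- The four unions of pairs of cosets of the index-8 subgroup of `𝔽_73ˣ` give a
representation of relation algebra `1316_1316`: every pairwise sumset contains
`𝔽_73 \ {0}`, and contains `0` exactly for the pairs `(A,A)`, `(B,B)`, `(R,R̆)`,
`(R̆,R)`. -/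
theorem stmt_19 : ∃ g : ZMod 73, IsPrimitiveRoot g 72 ∧
    ∀ R Rb A B : Set (ZMod 73),
      R = Xc 73 8 g 0 ∪ Xc 73 8 g 1 →
      Rb = Xc 73 8 g 4 ∪ Xc 73 8 g 5 →
      A = Xc 73 8 g 2 ∪ Xc 73 8 g 6 →
      B = Xc 73 8 g 3 ∪ Xc 73 8 g 7 →
      ∀ S ∈ ({R, Rb, A, B} : Set (Set (ZMod 73))),
        ∀ T ∈ ({R, Rb, A, B} : Set (Set (ZMod 73))),
          {(0 : ZMod 73)}ᶜ ⊆ S + T ∧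
          ((0 : ZMod 73) ∈ S + T ↔
            (S = A ∧ T = A) ∨ (S = B ∧ T = B) ∨ (S = R ∧ T = Rb) ∨ (S = Rb ∧ T = R)) := by
  refine ⟨5, isPrimitiveRoot_five, ?_⟩
  intro R Rb A B hR hRb hA hB
  replace hR : R = atomSet 0 := hR.trans (coe_cosetPair 0 1).symm
  replace hRb : Rb = atomSet 1 := hRb.trans (coe_cosetPair 4 5).symm
  replace hA : A = atomSet 2 := hA.trans (coe_cosetPair 2 6).symm
  replace hB : B = atomSet 3 := hB.trans (coe_cosetPair 3 7).symm
  subst hR hRb hA hB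
  have index : ∀ S ∈ ({(atomSet 0 : Set (ZMod 73)), (atomSet 1 : Set (ZMod 73)),
      (atomSet 2 : Set (ZMod 73)), (atomSet 3 : Set (ZMod 73))} : Set (Set (ZMod 73))),
      ∃ i, S = atomSet i := by
    rintro S (rfl | rfl | rfl | rfl) <;> exact ⟨_, rfl⟩
  intro S hS T hT
  obtain ⟨i, rfl⟩ := index S hS
  obtain ⟨j, rfl⟩ := index T hT
  constructor
  · intro x hx
    obtain ⟨a, ha, hxa⟩ := mem_atomSet_add_atomSet i j x hx
    exact ⟨a, ha, x - a, hxa, add_sub_cancel a x⟩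
  · simp only [Finset.coe_inj, atomSet_injective.eq_iff]
    rw [← exists_neg_mem_atomSet_iff i j, Set.mem_add]
    constructor
    · rintro ⟨a, ha, b, hb, hab⟩
      exact ⟨a, ha, by rwa [neg_eq_of_add_eq_zero_right hab]⟩
    · rintro ⟨a, ha, hb⟩
      exact ⟨a, ha, -a, hb, add_neg_cancel a⟩
end
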